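/- Let A be the companion matrix of f(x) = (x-1)^5 and B the companion matrix of g(x) = (x+1)(x²+x+1)(x²−x+1), and set T = B·A⁻¹ in GL(5,ℚ). Then T² = I with T ≠ I, B has order 6 and no power of B equals −I, and the hypergeometric group Γ(f,g) = ⟨A,B⟩ is the free product of the subgroup generated by T and the subgroup generated by B: the canonical group homomorphism from the abstract free product (ℤ/2ℤ) ∗ (ℤ/6ℤ) to GL(5,ℚ) sending the generator of ℤ/2ℤ to T and the generator of ℤ/6ℤ to B is injective with image Γ(f,g). -/

import Mathlib

open Polynomial Matrix

/-- The companion matrix of a monic degree-5 rational polynomial `p`: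
the `5 × 5` matrix whose entries in position `(i+1, i)` equal `1` for
`i = 1, ..., 4`, whose last column is `(-p₀, -p₁, -p₂, -p₃, -p₄)ᵀ`
(where `pᵢ` is the coefficient of `xⁱ` in `p`), and whose remaining
entries are `0`. -/
def companionMatrix (p : ℚ[X]) : Matrix (Fin 5) (Fin 5) ℚ :=
  Matrix.of fun i j : Fin 5 =>
    if (j : ℕ) = 4 then -p.coeff i
    else if (i : ℕ) = (j : ℕ) + 1 then 1 else 0

/-- The Ping-Pong lemma for the free product of two groups. -/
theorem Monoid.Coprod.lift_injective_of_ping_pong {G H : Type} {K α : Type*} [Group G] [Group H]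
    [Group K] [MulAction K α] (f : G →* K) (g : H →* K) (hcard : 3 ≤ Cardinal.mk H)
    {X Y : Set α} (hX : X.Nonempty) (hY : Y.Nonempty) (hXY : Disjoint X Y)
    (hf : ∀ a, a ≠ 1 → ∀ y ∈ Y, f a • y ∈ X) (hg : ∀ b, b ≠ 1 → ∀ x ∈ X, g b • x ∈ Y) :
    Function.Injective (Monoid.Coprod.lift f g) := by
  let F : Bool → Type := fun b => cond b G H
  let _ : ∀ b, Group (F b) := Bool.rec ‹Group H› ‹Group G›
  let φ : ∀ b, F b →* K := Bool.rec g f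
  let Z : Bool → Set α := fun b => cond b X Y
  have hinj : Function.Injective (Monoid.CoprodI.lift φ) := by
    refine Monoid.CoprodI.lift_injective_of_ping_pong φ (.inr ⟨false, hcard⟩) Z
      (Bool.rec hY hX) ?_ ?_
    · rintro (_ | _) (_ | _) h
      exacts [absurd rfl h, hXY.symm, hXY, absurd rfl h]
    · rintro (_ | _) (_ | _) h c hc
      · exact absurd rfl h
      · exact Set.smul_set_subset_iff.2 fun x hx => hg c hc x hx
      · exact Set.smul_set_subset_iff.2 fun y hy => hf c hc y hy
      · exact absurd rfl h
  let ι : Monoid.Coprod G H →* Monoid.CoprodI F :=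
    Monoid.Coprod.lift (Monoid.CoprodI.of (M := F) (i := true))
      (Monoid.CoprodI.of (M := F) (i := false))
  let π : Monoid.CoprodI F →* Monoid.Coprod G H :=
    Monoid.CoprodI.lift (Bool.rec Monoid.Coprod.inr Monoid.Coprod.inl)
  have hπι : π.comp ι = MonoidHom.id _ :=
    Monoid.Coprod.hom_ext (by ext x; simp [π, ι]) (by ext x; simp [π, ι])
  have hlift : Monoid.Coprod.lift f g = (Monoid.CoprodI.lift φ).comp ι :=
    Monoid.Coprod.hom_ext (by ext x; simp [φ, ι]) (by ext x; simp [φ, ι])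
  rw [hlift, MonoidHom.coe_comp]
  exact hinj.comp (Function.LeftInverse.injective (DFunLike.congr_fun hπι))

/-- The homomorphism from the cyclic group of order `n` sending the generator to an element `g`
with `g ^ n = 1`. -/
def zmodPowHom {G : Type*} [Group G] (n : ℕ) (g : G) (hg : g ^ n = 1) :
    Multiplicative (ZMod n) →* G :=
  AddMonoidHom.toMultiplicativeLeft
    (ZMod.lift n ⟨zmultiplesHom (Additive G) (Additive.ofMul g), by
      simpa using congrArg Additive.ofMul hg⟩)

theorem zmodPowHom_ofAdd_intCast {G : Type*} [Group G] {n : ℕ} {g : G} (hg : g ^ n = 1) (k : ℤ) :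
    zmodPowHom n g hg (Multiplicative.ofAdd (k : ZMod n)) = g ^ k := by
  simp [zmodPowHom]

theorem zmodPowHom_ofAdd_one {G : Type*} [Group G] {n : ℕ} {g : G} (hg : g ^ n = 1) :
    zmodPowHom n g hg (Multiplicative.ofAdd 1) = g := by
  simpa using zmodPowHom_ofAdd_intCast hg 1

theorem range_zmodPowHom {G : Type*} [Group G] {n : ℕ} {g : G} (hg : g ^ n = 1) :
    (zmodPowHom n g hg).range = Subgroup.zpowers g := by
  ext x
  rw [MonoidHom.mem_range, Subgroup.mem_zpowers_iff]
  constructor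
  · rintro ⟨a, rfl⟩
    obtain ⟨k, hk⟩ := ZMod.intCast_surjective a.toAdd
    exact ⟨k, by rw [← zmodPowHom_ofAdd_intCast hg, hk, ofAdd_toAdd]⟩
  · rintro ⟨k, rfl⟩
    exact ⟨_, zmodPowHom_ofAdd_intCast hg k⟩

namespace HypergeometricPingPong

/-- The companion matrix of `(X + 1) * (X ^ 2 + X + 1) * (X ^ 2 - X + 1)`. -/
def matB : Matrix (Fin 5) (Fin 5) ℚ :=
  !![0, 0, 0, 0, -1;
     1, 0, 0, 0, -1;
     0, 1, 0, 0, -1;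
     0, 0, 1, 0, -1;
     0, 0, 0, 1, -1]

/-- The reflection `B * A⁻¹`, where `A` is the companion matrix of `(X - 1) ^ 5`. -/
def matT : Matrix (Fin 5) (Fin 5) ℚ :=
  !![-1, 0, 0, 0, 0;
     4, 1, 0, 0, 0;
     -11, 0, 1, 0, 0;
     9, 0, 0, 1, 0;
     -6, 0, 0, 0, 1]

/-- Generators of a polyhedral cone preserved up to sign by `T * B ^ i` for `1 ≤ i ≤ 5`. -/
def rays : Fin 14 → Fin 5 → ℚ :=
  ![![1, -4, 6, -4, 1],
    ![1, 0, 5, -5, 5],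
    ![2, -7, 24, -22, 15],
    ![2, -13, 24, -22, 9],
    ![4, -11, 44, -41, 28],
    ![4, -24, 45, -40, 15],
    ![13, -66, 119, -104, 38],
    ![7, -7, 51, -46, 37],
    ![7, -30, 53, -44, 14],
    ![13, -25, 117, -106, 79],
    ![7, -5, 50, -50, 40],
    ![7, -33, 57, -43, 12],
    ![25, -23, 182, -170, 136],
    ![25, -111, 195, -157, 48]]

/-- Coefficients expressing the image of each ray under `(-1) ^ i • (T * B ^ (i + 1))` as a
nonnegative combination of rays. -/
def coeffs : Fin 5 → Fin 14 → List (Fin 14 × ℚ≥0) :=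
  ![![[(0, 1)],
      [(1, 1), (5, 1)],
      [(2, 1), (6, 1)],
      [(3, 1), (8, 1)],
      [(0, 4), (1, 4), (5, 5)],
      [(6, 1/2), (8, 1/2), (11, 5/12), (13, 1/12)],
      [(6, 1), (13, 1)],
      [(3, 9/2), (4, 7/4), (6, 3/4), (11, 5/12), (13, 1/3)],
      [(8, 1), (11, 1)],
      [(3, 6), (5, 2), (6, 3), (9, 1), (11, 1)],
      [(5, 5), (6, 1), (7, 1)],
      [(0, 5), (11, 1)],
      [(0, 19), (1, 10), (4, 2), (5, 23), (10, 1)],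
      [(0, 31/5), (11, 12/5), (13, 1)]],
    ![[(1, 1), (5, 1)],
      [(0, 2/5), (1, 1), (2, 4/5), (3, 14/5), (7, 1/5)],
      [(0, 4), (2, 3), (3, 8), (5, 1), (10, 1)],
      [(0, 4), (3, 25/3), (4, 8/9), (5, 1/3), (10, 7/9)],
      [(0, 1), (1, 1), (3, 22), (7, 8/3), (9, 1/3)],
      [(3, 33/2), (7, 1/8), (8, 1), (9, 1/8), (12, 1/2)],
      [(1, 144/5), (2, 23/5), (3, 103/5), (5, 15), (8, 2/5)],
      [(0, 2), (1, 15/4), (3, 51/2), (4, 7/4), (7, 11/4)],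
      [(0, 26/7), (3, 90/7), (5, 19/7), (6, 2/7), (10, 2)],
      [(0, 3), (1, 34), (2, 16), (3, 26), (5, 16)],
      [(0, 13/23), (1, 417/23), (2, 171/23), (3, 393/23), (5, 128/23)],
      [(1, 53/19), (3, 150/19), (5, 103/19), (8, 15/19), (10, 25/19)],
      [(0, 27), (1, 109/5), (3, 84), (4, 16), (10, 18/5)],
      [(1, 118/5), (3, 240/7), (5, 136/7), (10, 122/35), (13, 3/7)]],
    ![[(0, 2/5), (1, 1), (2, 4/5), (3, 14/5), (7, 1/5)],
      [(0, 1), (1, 2/5), (2, 14/5), (3, 4/5), (8, 1/5)],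
      [(0, 134/23), (1, 90/23), (2, 143/23), (3, 186/23), (4, 44/23)],
      [(0, 90/23), (1, 134/23), (2, 186/23), (3, 143/23), (5, 44/23)],
      [(0, 254/23), (1, 173/23), (2, 315/23), (3, 333/23), (4, 58/23)],
      [(0, 173/23), (1, 254/23), (2, 333/23), (3, 315/23), (5, 58/23)],
      [(0, 301/15), (1, 15), (2, 482/15), (3, 742/15), (7, 53/15)],
      [(0, 9), (1, 9), (2, 22), (3, 14), (8, 1)],
      [(0, 9), (1, 9), (2, 14), (3, 22), (7, 1)],
      [(0, 15), (1, 301/15), (2, 742/15), (3, 482/15), (8, 53/15)],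
      [(0, 319/23), (1, 201/23), (2, 555/23), (3, 249/23), (5, 43/23)],
      [(0, 201/23), (1, 319/23), (2, 249/23), (3, 555/23), (4, 43/23)],
      [(0, 985/23), (1, 843/23), (2, 1821/23), (3, 999/23), (5, 157/23)],
      [(0, 843/23), (1, 985/23), (2, 999/23), (3, 1821/23), (4, 157/23)]],
    ![[(0, 1), (1, 2/5), (2, 14/5), (3, 4/5), (8, 1/5)],
      [(0, 1), (4, 1)],
      [(1, 4), (2, 25/3), (4, 1/3), (5, 8/9), (11, 7/9)],
      [(1, 4), (2, 8), (3, 3), (4, 1), (11, 1)],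
      [(2, 33/2), (6, 1/8), (7, 1), (8, 1/8), (13, 1/2)],
      [(0, 1), (1, 1), (2, 22), (6, 1/3), (8, 8/3)],
      [(0, 34), (1, 3), (2, 26), (3, 16), (4, 16)],
      [(1, 26/7), (2, 90/7), (4, 19/7), (9, 2/7), (11, 2)],
      [(0, 15/4), (1, 2), (2, 51/2), (5, 7/4), (8, 11/4)],
      [(0, 144/5), (2, 103/5), (3, 23/5), (4, 15), (7, 2/5)],
      [(0, 53/19), (2, 150/19), (4, 103/19), (7, 15/19), (11, 25/19)],
      [(0, 417/23), (1, 13/23), (2, 393/23), (3, 171/23), (4, 128/23)],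
      [(0, 118/5), (2, 240/7), (4, 136/7), (11, 122/35), (12, 3/7)],
      [(0, 47), (1, 9/5), (2, 84), (5, 16), (10, 18/5)]],
    ![[(0, 1), (4, 1)],
      [(1, 1)],
      [(2, 1), (7, 1)],
      [(3, 1), (9, 1)],
      [(7, 1/2), (9, 1/2), (10, 5/12), (12, 1/12)],
      [(0, 4), (1, 4), (4, 5)],
      [(2, 6), (4, 2), (6, 1), (9, 3), (10, 1)],
      [(7, 1), (10, 1)],
      [(2, 9/2), (5, 7/4), (9, 3/4), (10, 5/12), (12, 1/3)],
      [(9, 1), (12, 1)],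
      [(1, 5), (10, 1)],
      [(4, 5), (8, 1), (9, 1)],
      [(1, 31/5), (10, 12/5), (12, 1)],
      [(0, 17), (1, 12), (4, 23), (5, 2), (10, 1)]]]

/-- The polyhedral cone generated by `rays`. -/
def cone : PointedCone ℚ (Fin 5 → ℚ) :=
  PointedCone.hull ℚ (Set.range rays)

/-- A functional invariant under `T`, nonnegative on `cone`. -/
def height : (Fin 5 → ℚ) →ₗ[ℚ] ℚ :=
  LinearMap.proj (R := ℚ) (φ := fun _ => ℚ) 2 - LinearMap.proj 3 - (10 : ℚ) • LinearMap.proj 0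

theorem height_apply (v : Fin 5 → ℚ) : height v = v 2 - v 3 - 10 * v 0 := rfl

theorem smul_mulVec_rays (i : Fin 5) (k : Fin 14) :
    ((-1 : ℚ) ^ (i : ℕ) • (matT * matB ^ (i + 1 : ℕ))) *ᵥ rays k =
      ((coeffs i k).map fun p => (p.2 : ℚ) • rays p.1).sum := by
  revert i k
  decide +kernel

theorem height_rays_le (i : Fin 5) (k : Fin 14) :
    0 ≤ height (((-1 : ℚ) ^ (i : ℕ) • (matT * matB ^ (i + 1 : ℕ))) *ᵥ rays k) -
      height (rays k) := by
  simp only [height_apply]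
  revert i k
  decide +kernel

theorem nonneg_of_mem_cone (ψ : (Fin 5 → ℚ) →ₗ[ℚ] ℚ) (hψ : ∀ k, 0 ≤ ψ (rays k))
    {v : Fin 5 → ℚ} (hv : v ∈ cone) : 0 ≤ ψ v := by
  induction hv using Submodule.span_induction with
  | mem x hx => obtain ⟨k, rfl⟩ := hx; exact hψ k
  | zero => simp
  | add x y _ _ hx hy => rw [map_add]; exact add_nonneg hx hy
  | smul c x _ hx =>
    rw [show c • x = (c : ℚ) • x from rfl, map_smul]
    exact mul_nonneg c.2 hx

theorem smul_mulVec_mem_cone (i : Fin 5) {v : Fin 5 → ℚ} (hv : v ∈ cone) :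
    ((-1 : ℚ) ^ (i : ℕ) • (matT * matB ^ (i + 1 : ℕ))) *ᵥ v ∈ cone := by
  induction hv using Submodule.span_induction with
  | mem x hx =>
    obtain ⟨k, rfl⟩ := hx
    rw [smul_mulVec_rays]
    refine list_sum_mem fun w hw => ?_
    obtain ⟨p, -, rfl⟩ := List.mem_map.1 hw
    exact Submodule.smul_mem cone p.2 (Submodule.subset_span ⟨p.1, rfl⟩)
  | zero => rw [mulVec_zero]; exact cone.zero_mem
  | add x y _ _ hx hy => rw [mulVec_add]; exact cone.add_mem hx hy
  | smul c x _ hx =>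
    rw [show c • x = (c : ℚ) • x from rfl, mulVec_smul]
    exact Submodule.smul_mem cone c hx

theorem height_le_mulVec (i : Fin 5) {v : Fin 5 → ℚ} (hv : v ∈ cone) :
    height v ≤ height (((-1 : ℚ) ^ (i : ℕ) • (matT * matB ^ (i + 1 : ℕ))) *ᵥ v) :=
  sub_nonneg.1 <| nonneg_of_mem_cone
    (height ∘ₗ mulVecLin ((-1 : ℚ) ^ (i : ℕ) • (matT * matB ^ (i + 1 : ℕ))) - height)
    (height_rays_le i) hv

theorem height_le_apply_zero {v : Fin 5 → ℚ} (hv : v ∈ cone) : height v ≤ 13 * v 0 :=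
  sub_nonneg.1 <| nonneg_of_mem_cone
    ((13 : ℚ) • LinearMap.proj (R := ℚ) (φ := fun _ => ℚ) 0 - height)
    (show ∀ k, 0 ≤ 13 * rays k 0 - (rays k 2 - rays k 3 - 10 * rays k 0) by decide +kernel) hv

theorem matT_mulVec_apply_zero (v : Fin 5 → ℚ) : (matT *ᵥ v) 0 = -v 0 := by
  simp [matT, mulVec, dotProduct, Fin.sum_univ_succ]

theorem height_matT_mulVec (v : Fin 5 → ℚ) : height (matT *ᵥ v) = height v := by
  simp [height_apply, matT, dotProduct, Fin.sum_univ_succ]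
  ring

/-- The companion matrix of `(X - 1) ^ 5`. -/
def matA : Matrix (Fin 5) (Fin 5) ℚ :=
  !![0, 0, 0, 0, 1;
     1, 0, 0, 0, -5;
     0, 1, 0, 0, 10;
     0, 0, 1, 0, -10;
     0, 0, 0, 1, 5]

theorem companionMatrix_eq_matA : companionMatrix ((X - 1) ^ 5) = matA := by
  rw [show ((X - 1) ^ 5 : ℚ[X]) = X ^ 5 - 5 * X ^ 4 + 10 * X ^ 3 - 10 * X ^ 2 + 5 * X - 1 by ring]
  ext i j
  fin_cases i <;> fin_cases j <;>
    simp [companionMatrix, matA, coeff_X, coeff_one, coeff_X_pow]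

theorem companionMatrix_eq_matB :
    companionMatrix ((X + 1) * (X ^ 2 + X + 1) * (X ^ 2 - X + 1)) = matB := by
  rw [show ((X + 1) * (X ^ 2 + X + 1) * (X ^ 2 - X + 1) : ℚ[X]) =
    X ^ 5 + X ^ 4 + X ^ 3 + X ^ 2 + X + 1 by ring]
  ext i j
  fin_cases i <;> fin_cases j <;>
    simp [companionMatrix, matB, coeff_X, coeff_one, coeff_X_pow]

theorem matT_mul_matA : matT * matA = matB := by decide +kernel

theorem matT_sq : matT ^ 2 = 1 := by decide +kernel

theorem matB_pow_six : matB ^ 6 = 1 := by decide +kernel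

/-- The vectors which lie, up to sign, in `cone` and have positive height there. -/
def pingSet : Set (Fin 5 → ℚ) :=
  {v | ∃ s : ℤˣ, s • v ∈ cone ∧ 0 < height (s • v)}

theorem pow_mulVec_mem_pingSet (i : Fin 5) {v : Fin 5 → ℚ} (hv : v ∈ pingSet) :
    matT *ᵥ matB ^ (i + 1 : ℕ) *ᵥ v ∈ pingSet := by
  obtain ⟨s, hs, hpos⟩ := hv
  have key : ((-1) ^ (i : ℕ) * s) • matT *ᵥ matB ^ (i + 1 : ℕ) *ᵥ v =
      ((-1 : ℚ) ^ (i : ℕ) • (matT * matB ^ (i + 1 : ℕ))) *ᵥ (s • v) := by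
    rcases Int.units_eq_one_or s with rfl | rfl <;>
      rcases Nat.even_or_odd (i : ℕ) with h | h <;>
      simp [h.neg_one_pow, neg_mulVec, mulVec_neg]
  refine ⟨(-1) ^ (i : ℕ) * s, ?_, ?_⟩ <;> rw [key]
  · exact smul_mulVec_mem_cone i hs
  · exact hpos.trans_le (height_le_mulVec i hs)

theorem matT_mulVec_notMem_pingSet {v : Fin 5 → ℚ} (hv : v ∈ pingSet) :
    matT *ᵥ v ∉ pingSet := by
  rintro ⟨t, ht, htpos⟩
  obtain ⟨s, hs, hspos⟩ := hv
  have h1 := height_le_apply_zero hs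
  have h2 := height_le_apply_zero ht
  have h3 := height_matT_mulVec v
  have h4 := matT_mulVec_apply_zero v
  rcases Int.units_eq_one_or s with rfl | rfl <;>
    rcases Int.units_eq_one_or t with rfl | rfl <;>
    simp only [one_smul, Units.neg_smul, map_neg, Pi.neg_apply] at * <;>
    linarith

theorem pingSet_nonempty : pingSet.Nonempty :=
  ⟨rays 2, 1, by rw [one_smul]; exact Submodule.subset_span ⟨2, rfl⟩,
    by rw [one_smul, height_apply]; decide +kernel⟩

end HypergeometricPingPong

open HypergeometricPingPong

/-- `Γ(f,g) = ⟨T⟩ ∗ ⟨B⟩` for `f = ((X - 1) ^ 5)`, `g = ((X + 1) * (X ^ 2 + X + 1) * (X ^ 2 - X + 1))`. -/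
theorem hypergeometric_free_product_case4 (A B T : GL (Fin 5) ℚ)
    (hA : (↑A : Matrix (Fin 5) (Fin 5) ℚ) = companionMatrix ((X - 1) ^ 5))
    (hB : (↑B : Matrix (Fin 5) (Fin 5) ℚ) = companionMatrix ((X + 1) * (X ^ 2 + X + 1) * (X ^ 2 - X + 1)))
    (hT : T = B * A⁻¹) :
    T ^ 2 = 1 ∧ T ≠ 1 ∧ orderOf B = 6 ∧ (∀ i : ℤ, B ^ i ≠ -1) ∧
    ∃ φ : Monoid.Coprod (Multiplicative (ZMod 2)) (Multiplicative (ZMod 6)) →* GL (Fin 5) ℚ,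
      φ (Monoid.Coprod.inl (Multiplicative.ofAdd (1 : ZMod 2))) = T ∧
      φ (Monoid.Coprod.inr (Multiplicative.ofAdd (1 : ZMod 6))) = B ∧
      Function.Injective φ ∧
      φ.range = Subgroup.closure {A, B} := by
  rw [companionMatrix_eq_matA] at hA
  rw [companionMatrix_eq_matB] at hB
  have hTm : (T : Matrix (Fin 5) (Fin 5) ℚ) = matT := by
    have h : (T : Matrix (Fin 5) (Fin 5) ℚ) * A = matT * A := by
      rw [← Units.val_mul, hT, inv_mul_cancel_right, hA, hB, matT_mul_matA]
    exact A.isUnit.mul_left_injective h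
  have hT2 : T ^ 2 = 1 := Units.ext (by rw [Units.val_pow_eq_pow_val, hTm, matT_sq, Units.val_one])
  have hB6 : B ^ 6 = 1 :=
    Units.ext (by rw [Units.val_pow_eq_pow_val, hB, matB_pow_six, Units.val_one])
  have hT1 : T ≠ 1 := fun h => by
    have : matT = 1 := by rw [← hTm, h, Units.val_one]
    exact absurd this (by decide +kernel)
  have hBpow : ∀ k : ℕ, ((B ^ k : GL (Fin 5) ℚ) : Matrix (Fin 5) (Fin 5) ℚ) = matB ^ k :=
    fun k => by rw [Units.val_pow_eq_pow_val, hB]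
  refine ⟨hT2, hT1, ?_, fun i h => ?_,
    Monoid.Coprod.lift (zmodPowHom 2 T hT2) (zmodPowHom 6 B hB6), ?_, ?_, ?_, ?_⟩
  · rw [orderOf_eq_iff (by norm_num)]
    refine ⟨hB6, fun m hm hm0 h => ?_⟩
    have h' : matB ^ m = 1 := by rw [← hBpow, h, Units.val_one]
    exact (show ∀ m < 6, 0 < m → matB ^ m ≠ 1 by decide +kernel) m hm hm0 h'
  · have h' : B ^ (i % 6).toNat = -1 := by
      rw [← h, ← zpow_natCast, Int.toNat_of_nonneg (Int.emod_nonneg i (by norm_num))]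
      exact zpow_eq_zpow_emod' i hB6 |>.symm
    have h'' : matB ^ (i % 6).toNat = -1 := by rw [← hBpow, h', Units.val_neg, Units.val_one]
    exact (show ∀ m < 6, matB ^ m ≠ -1 by decide +kernel) _ (by omega) h''
  · rw [Monoid.Coprod.lift_apply_inl, zmodPowHom_ofAdd_one]
  · rw [Monoid.Coprod.lift_apply_inr, zmodPowHom_ofAdd_one]
  · have hT_smul (v : Fin 5 → ℚ) : T • v = matT *ᵥ v := by rw [← hTm]; rfl
    have hTT (v : Fin 5 → ℚ) : matT *ᵥ matT *ᵥ v = v := by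
      rw [mulVec_mulVec, ← sq, matT_sq, one_mulVec]
    refine Monoid.Coprod.lift_injective_of_ping_pong _ _ ?_ (X := pingSet)
      (Y := {v | matT *ᵥ v ∈ pingSet}) pingSet_nonempty ?_ ?_ ?_ ?_
    · rw [Cardinal.mk_fintype, Fintype.card_multiplicative, ZMod.card]
      norm_num
    · obtain ⟨v, hv⟩ := pingSet_nonempty
      exact ⟨matT *ᵥ v, by rwa [Set.mem_ofPred_eq, hTT]⟩
    · exact Set.disjoint_left.2 fun v hv => matT_mulVec_notMem_pingSet hv
    · intro a ha v hv
      obtain rfl : a = Multiplicative.ofAdd 1 := by revert a; decide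
      rwa [zmodPowHom_ofAdd_one, hT_smul]
    · intro b hb v hv
      obtain ⟨i, rfl⟩ : ∃ i : Fin 5, b = Multiplicative.ofAdd (((i + 1 : ℕ) : ℤ) : ZMod 6) := by
        revert b; decide
      rw [zmodPowHom_ofAdd_intCast, zpow_natCast]
      change matT *ᵥ ((B ^ (i + 1 : ℕ) : GL (Fin 5) ℚ) : Matrix (Fin 5) (Fin 5) ℚ) *ᵥ v ∈ pingSet
      rw [hBpow]
      exact pow_mulVec_mem_pingSet i hv
  · rw [Monoid.Coprod.range_lift, range_zmodPowHom, range_zmodPowHom, Subgroup.zpowers_eq_closure,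
      Subgroup.zpowers_eq_closure, ← Subgroup.closure_union]
    have hA' : A = T⁻¹ * B := by rw [hT]; group
    apply le_antisymm <;> rw [Subgroup.closure_le]
    · have hBmem : B ∈ Subgroup.closure {A, B} := Subgroup.subset_closure (by simp)
      rintro x (rfl | rfl)
      · rw [hT]
        exact mul_mem hBmem (inv_mem (Subgroup.subset_closure (by simp)))
      · exact hBmem
    · have hBmem : B ∈ Subgroup.closure ({T} ∪ {B}) := Subgroup.subset_closure (by simp)
      rintro x (rfl | rfl)
      · rw [hA']
        exact mul_mem (inv_mem (Subgroup.subset_closure (by simp))) hBmem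
      · exact hBmem
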